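/- arXiv:1808.02359 — 2 statements merged into one kernel-verified Lean document; each statement's English description precedes it below -/
import Mathlib

section
/- Let G be a connected graph on n vertices, x a vertex of G with exactly three neighbors, y and z two distinct neighbors of x, and c ≥ 0 an integer; let G' be the associated terminal-augmented graph with terminals s and t. Then G has a Hamiltonian cycle if and only if G' contains an st-path P with |N_{G'}(V(P))| ≤ c. -/
open SimpleGraph

/-- The open neighborhood of a vertex set `S`: vertices outside `S` adjacent to some
vertex of `S`. -/
def openNbhd {V : Type*} (G : SimpleGraph V) (S : Set V) : Set V :=
  {v | v ∉ S ∧ ∃ w ∈ S, G.Adj v w}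

/-- The terminal-augmented graph `G'` of `(G, x, y, z, c)`: a new vertex `s`
(modelled as `Sum.inr (Sum.inl ())`) adjacent exactly to `x`, a new vertex `t`
(modelled as `Sum.inr (Sum.inr (Sum.inl ()))`) adjacent exactly to `y` and `z`,
and `c` new vertices (the set `Z`, modelled as `Sum.inr (Sum.inr (Sum.inr i))`)
each adjacent exactly to `s`. -/
def termAug {V : Type*} (G : SimpleGraph V) (x y z : V) (c : ℕ) :
    SimpleGraph (V ⊕ (Unit ⊕ Unit ⊕ Fin c)) :=
  SimpleGraph.fromRel (fun a b =>
    match a, b with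
    | Sum.inl v, Sum.inl w => G.Adj v w
    | Sum.inl v, Sum.inr (Sum.inl _) => v = x
    | Sum.inl v, Sum.inr (Sum.inr (Sum.inl _)) => v = y ∨ v = z
    | Sum.inr (Sum.inl _), Sum.inr (Sum.inr (Sum.inr _)) => True
    | _, _ => False)

/-- The terminal `s` of the terminal-augmented graph. -/
def sVert (V : Type*) (c : ℕ) : V ⊕ (Unit ⊕ Unit ⊕ Fin c) := Sum.inr (Sum.inl ())

/-- The terminal `t` of the terminal-augmented graph. -/
def tVert (V : Type*) (c : ℕ) : V ⊕ (Unit ⊕ Unit ⊕ Fin c) := Sum.inr (Sum.inr (Sum.inl ()))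

/-- `G` has a Hamiltonian cycle. -/
def HasHamiltonianCycle {V : Type*} [DecidableEq V] (G : SimpleGraph V) : Prop :=
  ∃ (v : V) (p : G.Walk v v), p.IsHamiltonianCycle

section TermAug

variable {V : Type*} {G : SimpleGraph V} {x y z : V} {c : ℕ}

@[simp] lemma termAug_adj_inl_inl {v w : V} :
    (termAug G x y z c).Adj (Sum.inl v) (Sum.inl w) ↔ G.Adj v w := by
  simp only [termAug, fromRel_adj, ne_eq, Sum.inl.injEq, G.adj_comm w v, or_self]
  exact ⟨And.right, fun h => ⟨h.ne, h⟩⟩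

@[simp] lemma termAug_adj_inl_sVert {v : V} :
    (termAug G x y z c).Adj (Sum.inl v) (sVert V c) ↔ v = x := by
  simp [termAug, sVert]

@[simp] lemma termAug_adj_inl_tVert {v : V} :
    (termAug G x y z c).Adj (Sum.inl v) (tVert V c) ↔ v = y ∨ v = z := by
  simp [termAug, tVert]

@[simp] lemma not_termAug_adj_inl_pendant {v : V} {i : Fin c} :
    ¬ (termAug G x y z c).Adj (Sum.inl v) (Sum.inr (Sum.inr (Sum.inr i))) := by
  simp [termAug]

@[simp] lemma not_termAug_adj_sVert_tVert :
    ¬ (termAug G x y z c).Adj (sVert V c) (tVert V c) := by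
  simp [termAug, sVert, tVert]

lemma termAug_adj_pendant_iff {a : V ⊕ (Unit ⊕ Unit ⊕ Fin c)} {i : Fin c} :
    (termAug G x y z c).Adj (Sum.inr (Sum.inr (Sum.inr i))) a ↔ a = sVert V c := by
  rcases a with v | _ | _ | j <;> simp [termAug, sVert]

/-- The inclusion of `G` into the terminal-augmented graph. -/
def termAugInl (G : SimpleGraph V) (x y z : V) (c : ℕ) : G →g termAug G x y z c where
  toFun := Sum.inl
  map_rel' h := termAug_adj_inl_inl.2 h

/-- Paths from an old vertex to `t` avoiding `s` stay in `G` until the last step. -/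
lemma exists_walk_of_walk_tVert {a b : V ⊕ (Unit ⊕ Unit ⊕ Fin c)}
    (q : (termAug G x y z c).Walk a b) (hq : q.IsPath) (hb : b = tVert V c)
    (hs : sVert V c ∉ q.support) {v : V} (ha : a = Sum.inl v) :
    ∃ u, (u = y ∨ u = z) ∧ ∃ r : G.Walk v u,
      q.support = r.support.map Sum.inl ++ [tVert V c] := by
  induction q generalizing v with
  | nil => simp [ha, tVert] at hb
  | @cons a d b h p ih =>
    subst ha hb
    rw [Walk.cons_isPath_iff] at hq
    rw [Walk.support_cons, List.mem_cons, not_or] at hs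
    rcases d with w | _ | _ | i
    · obtain ⟨u, hu, r, hr⟩ := ih hq.1 rfl hs.2 rfl
      exact ⟨u, hu, Walk.cons (termAug_adj_inl_inl.1 h) r, by simp [hr]⟩
    · exact absurd p.start_mem_support hs.2
    · have hv := termAug_adj_inl_tVert.1 h
      obtain rfl := Walk.eq_nil_iff_nil.2 (Walk.isPath_iff_nil.1 hq.1)
      exact ⟨v, hv, Walk.nil, by simp [tVert]⟩
    · exact absurd h not_termAug_adj_inl_pendant

/-- Every `st`-path of the terminal-augmented graph is a path of `G` from `x` to `y` or `z`
extended by the terminals. -/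
lemma exists_walk_of_isPath_sVert_tVert
    (p : (termAug G x y z c).Walk (sVert V c) (tVert V c)) (hp : p.IsPath) :
    ∃ u, (u = y ∨ u = z) ∧ ∃ r : G.Walk x u, r.IsPath ∧
      p.support = sVert V c :: (r.support.map Sum.inl ++ [tVert V c]) := by
  obtain ⟨d, h, q, rfl⟩ := Walk.exists_eq_cons_of_ne (by simp [sVert, tVert]) p
  rw [Walk.cons_isPath_iff] at hp
  rcases d with w | _ | _ | i
  · obtain rfl := termAug_adj_inl_sVert.1 h.symm
    obtain ⟨u, hu, r, hr⟩ := exists_walk_of_walk_tVert q hp.1 rfl hp.2 rfl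
    refine ⟨u, hu, r, ?_, by rw [Walk.support_cons, hr]⟩
    have := hp.1.support_nodup
    rw [hr] at this
    exact Walk.IsPath.mk' (this.of_append_left.of_map _)
  · exact absurd q.start_mem_support hp.2
  · exact absurd h not_termAug_adj_sVert_tVert
  · obtain ⟨e, h', q', rfl⟩ := Walk.exists_eq_cons_of_ne (by simp [tVert]) q
    obtain rfl := termAug_adj_pendant_iff.1 h'
    exact absurd (by simp) hp.2

/-- A path of `G` from `x` to `y` or `z` extends to an `st`-path. -/
lemma exists_isPath_sVert_tVert {u : V} (hu : u = y ∨ u = z) {r : G.Walk x u} (hr : r.IsPath) :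
    ∃ p : (termAug G x y z c).Walk (sVert V c) (tVert V c), p.IsPath ∧
      p.support = sVert V c :: (r.support.map Sum.inl ++ [tVert V c]) := by
  obtain ⟨m, hm, hsupp⟩ : ∃ m : (termAug G x y z c).Walk (Sum.inl x) (Sum.inl u),
      m.IsPath ∧ m.support = r.support.map Sum.inl :=
    ⟨r.map (termAugInl G x y z c), hr.map Sum.inl_injective, Walk.support_map _ _⟩
  refine ⟨Walk.cons (termAug_adj_inl_sVert.2 rfl).symm
    (m.concat (termAug_adj_inl_tVert.2 hu)), ?_, by simp [Walk.support_concat, hsupp]⟩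
  rw [Walk.cons_isPath_iff]
  refine ⟨hm.concat ?_ _, ?_⟩
  · simp [hsupp, tVert]
  · rw [Walk.support_concat, hsupp]
    simp [sVert, tVert]

lemma ncard_range_pendant :
    (Set.range fun i : Fin c =>
      (Sum.inr (Sum.inr (Sum.inr i)) : V ⊕ (Unit ⊕ Unit ⊕ Fin c))).ncard = c := by
  rw [← Set.image_univ, Set.ncard_image_of_injective _ fun i j h => by simpa using h]
  simp

/-- The neighborhood of an `st`-path has at most `c` elements iff the path covers `G`. -/
lemma ncard_openNbhd_le_iff [Finite V] (hG : G.Connected) {u : V} (r : G.Walk x u) :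
    (openNbhd (termAug G x y z c)
      {a | a ∈ sVert V c :: (r.support.map Sum.inl ++ [tVert V c])}).ncard ≤ c ↔
      ∀ v, v ∈ r.support := by
  set N := openNbhd (termAug G x y z c)
    {a | a ∈ sVert V c :: (r.support.map Sum.inl ++ [tVert V c])}
  set Z := Set.range fun i : Fin c =>
    (Sum.inr (Sum.inr (Sum.inr i)) : V ⊕ (Unit ⊕ Unit ⊕ Fin c)) with hZ
  have hcard : Z.ncard = c := ncard_range_pendant
  constructor
  · intro h
    have hsub : Z ⊆ N := by
      rintro _ ⟨i, rfl⟩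
      exact ⟨by simp [sVert, tVert], sVert V c, by simp, termAug_adj_pendant_iff.2 rfl⟩
    have heq : Z = N := Set.eq_of_subset_of_ncard_le hsub (by rwa [hcard])
    by_contra! hv
    obtain ⟨v, hv⟩ := hv
    obtain ⟨w⟩ := hG.preconnected x v
    obtain ⟨d, -, h₁, h₂⟩ :=
      w.exists_boundary_dart {v | v ∈ r.support} r.start_mem_support hv
    have hd : Sum.inl d.snd ∈ N := by
      refine ⟨?_, Sum.inl d.fst, ?_, termAug_adj_inl_inl.2 d.adj.symm⟩
      · simpa [sVert, tVert] using h₂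
      · simpa [sVert, tVert] using h₁
    rw [← heq] at hd
    simp [hZ] at hd
  · intro h
    refine (Set.ncard_le_ncard ?_ (Set.toFinite _)).trans hcard.le
    rintro (v | _ | _ | i) ⟨ha, -⟩
    · simp [h v] at ha
    · simp [sVert] at ha
    · simp [tVert] at ha
    · exact ⟨i, rfl⟩

end TermAug

/-- With `x` of degree three, a Hamiltonian cycle uses an edge from `x` to one of two given
neighbors, and removing it leaves a Hamiltonian path. -/
lemma hasHamiltonianCycle_iff_exists_isHamiltonian {V : Type*} [Fintype V] [DecidableEq V]
    {G : SimpleGraph V} {x y z : V} (hx : (G.neighborSet x).ncard = 3)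
    (hy : G.Adj x y) (hz : G.Adj x z) (hyz : y ≠ z) :
    HasHamiltonianCycle G ↔ ∃ u, (u = y ∨ u = z) ∧ ∃ r : G.Walk x u, r.IsHamiltonian := by
  constructor
  · rintro ⟨v, p, hp⟩
    obtain ⟨C, hC⟩ : ∃ C : G.Walk x x, C.IsHamiltonianCycle :=
      ⟨p.rotate x (hp.mem_support x), hp.rotate _⟩
    have key : ∀ C : G.Walk x x, C.IsHamiltonianCycle → (C.snd = y ∨ C.snd = z) →
        ∃ u, (u = y ∨ u = z) ∧ ∃ r : G.Walk x u, r.IsHamiltonian := fun C hC h =>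
      ⟨C.snd, h, C.tail.reverse, fun a => by
        rw [Walk.support_reverse, List.count_reverse, hC.isHamiltonian_tail a]⟩
    by_cases h₁ : C.snd = y ∨ C.snd = z
    · exact key C hC h₁
    by_cases h₂ : C.penultimate = y ∨ C.penultimate = z
    · refine key C.reverse ?_ (by rwa [Walk.snd_reverse])
      rw [Walk.isHamiltonianCycle_iff_isCycle_and_length_eq] at hC ⊢
      exact ⟨hC.1.reverse, by rw [Walk.length_reverse, hC.2]⟩
    exfalso
    push Not at h₁ h₂
    have hsub : (({y, z, C.snd, C.penultimate} : Finset V) : Set V) ⊆ G.neighborSet x := by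
      intro a ha
      simp only [Finset.coe_insert, Finset.coe_singleton, Set.mem_insert_iff,
        Set.mem_singleton_iff] at ha
      rcases ha with rfl | rfl | rfl | rfl
      · exact hy
      · exact hz
      · exact C.adj_snd hC.not_nil
      · exact (C.adj_penultimate hC.not_nil).symm
    have hle := Set.ncard_le_ncard hsub (Set.toFinite _)
    have hne := hC.isCycle.snd_ne_penultimate
    rw [Set.ncard_coe_finset, hx] at hle
    have h4 : ({y, z, C.snd, C.penultimate} : Finset V).card = 4 := by
      grind
    omega
  · rintro ⟨u, hu, r, hr⟩
    have hxu : G.Adj x u := by rcases hu with rfl | rfl <;> assumption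
    have hcard : 3 < Fintype.card V := by
      rw [← hx, ← Nat.card_eq_fintype_card, ← Set.ncard_univ]
      exact Set.ncard_lt_ncard (Set.ssubset_univ_iff.2 fun h =>
        G.loopless.irrefl x (h ▸ Set.mem_univ x : x ∈ G.neighborSet x)) (Set.toFinite _)
    have hlen := hr.length_eq
    refine ⟨u, Walk.cons hxu.symm r, ?_⟩
    rw [Walk.isHamiltonianCycle_iff_isCycle_and_length_eq, Walk.cons_isCycle_iff,
      Walk.length_cons]
    refine ⟨⟨hr.isPath, fun h => ?_⟩, by omega⟩
    have := hr.isPath.length_eq_one_of_mem_edges (Sym2.eq_swap ▸ h)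
    omega

/-- `G` has a Hamiltonian cycle iff the terminal-augmented graph `G'` contains an
`st`-path `P` with `|N_{G'}(V(P))| ≤ c`. -/
theorem stmt_6 {V : Type*} [Fintype V] [DecidableEq V] (G : SimpleGraph V)
    (hG : G.Connected) (x y z : V) (hx : (G.neighborSet x).ncard = 3)
    (hy : G.Adj x y) (hz : G.Adj x z) (hyz : y ≠ z) (c : ℕ) :
    HasHamiltonianCycle G ↔
      ∃ p : (termAug G x y z c).Walk (sVert V c) (tVert V c), p.IsPath ∧
        (openNbhd (termAug G x y z c) {a | a ∈ p.support}).ncard ≤ c := by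
  rw [hasHamiltonianCycle_iff_exists_isHamiltonian hx hy hz hyz]
  constructor
  · rintro ⟨u, hu, r, hr⟩
    obtain ⟨p, hp, hsupp⟩ := exists_isPath_sVert_tVert (c := c) hu hr.isPath
    refine ⟨p, hp, ?_⟩
    rw [hsupp]
    exact (ncard_openNbhd_le_iff hG r).2 hr.mem_support
  · rintro ⟨p, hp, hle⟩
    obtain ⟨u, hu, r, hr, hsupp⟩ := exists_walk_of_isPath_sVert_tVert p hp
    rw [hsupp] at hle
    exact ⟨u, hu, r, hr.isHamiltonian_of_mem ((ncard_openNbhd_le_iff hG r).1 hle)⟩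
end

section
/- Let G be a graph on n ≥ 2 vertices, k ≥ 1 and ℓ ≥ 0 integers, and let G' with terminals s, t be the pair-copies graph of G. Then G contains a path P with at least two vertices such that |V(P)| ≥ k and |N_G(V(P))| ≤ ℓ if and only if G' contains an st-path P' with |V(P')| ≥ k + 2 and |N_{G'}(V(P'))| ≤ ℓ + 2(binom(n,2) − 1). -/
open SimpleGraph

/-- The pair-copies graph `G'` of a graph `G` with a linear order on its vertices:
for every pair `v < w` of vertices of `G` there is a disjoint copy of `G`
(modelled as `Sum.inl (⟨(v, w), _⟩, a)` for `a : V`), together with two new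
vertices `s = Sum.inr false` and `t = Sum.inr true`, where `s` is adjacent exactly
to the copy of `v` in each copy `G_{vw}`, and `t` is adjacent exactly to the copy
of `w` in each copy `G_{vw}`. -/
def pairCopies {V : Type*} [LinearOrder V] (G : SimpleGraph V) :
    SimpleGraph (({q : V × V // q.1 < q.2} × V) ⊕ Bool) :=
  SimpleGraph.fromRel (fun a b =>
    match a, b with
    | Sum.inl (e, a), Sum.inl (e', b) => e = e' ∧ G.Adj a b
    | Sum.inr false, Sum.inl (e, a) => a = e.1.1
    | Sum.inr true, Sum.inl (e, a) => a = e.1.2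
    | _, _ => False)

section PairCopies

variable {V : Type*} [LinearOrder V] (G : SimpleGraph V)

theorem pairCopies_adj_inl_inl (e e' : {q : V × V // q.1 < q.2}) (a b : V) :
    (pairCopies G).Adj (Sum.inl (e, a)) (Sum.inl (e', b)) ↔ e = e' ∧ G.Adj a b := by
  simp only [pairCopies, SimpleGraph.fromRel_adj]
  constructor
  · rintro ⟨-, h | ⟨h, h'⟩⟩
    · exact h
    · exact ⟨h.symm, h'.symm⟩
  · rintro ⟨rfl, h⟩
    exact ⟨by simpa using h.ne, Or.inl ⟨rfl, h⟩⟩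

theorem pairCopies_adj_inl_false (e : {q : V × V // q.1 < q.2}) (a : V) :
    (pairCopies G).Adj (Sum.inl (e, a)) (Sum.inr false) ↔ a = e.1.1 := by
  simp [pairCopies, SimpleGraph.fromRel_adj]

theorem pairCopies_adj_inl_true (e : {q : V × V // q.1 < q.2}) (a : V) :
    (pairCopies G).Adj (Sum.inl (e, a)) (Sum.inr true) ↔ a = e.1.2 := by
  simp [pairCopies, SimpleGraph.fromRel_adj]

theorem not_pairCopies_adj_inr_inr (b c : Bool) :
    ¬ (pairCopies G).Adj (Sum.inr b) (Sum.inr c) := by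
  cases b <;> cases c <;> simp [pairCopies, SimpleGraph.fromRel_adj]

/-- The inclusion of `G` into `pairCopies G` as the copy indexed by `e`. -/
def pairCopiesHom (e : {q : V × V // q.1 < q.2}) : G →g pairCopies G where
  toFun a := Sum.inl (e, a)
  map_rel' h := (pairCopies_adj_inl_inl G e e _ _).2 ⟨rfl, h⟩

theorem pairCopiesHom_apply (e : {q : V × V // q.1 < q.2}) (a : V) :
    pairCopiesHom G e a = Sum.inl (e, a) := rfl

theorem pairCopiesHom_injective (e : {q : V × V // q.1 < q.2}) :
    Function.Injective (pairCopiesHom G e) := by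
  intro a b h
  simpa [pairCopiesHom_apply] using h

theorem exists_walk_of_isPath_inl_true {e : {q : V × V // q.1 < q.2}}
    {x : ({q : V × V // q.1 < q.2} × V) ⊕ Bool} {y : ({q : V × V // q.1 < q.2} × V) ⊕ Bool}
    (q : (pairCopies G).Walk x y) (hq : q.IsPath) (hs : Sum.inr false ∉ q.support)
    (hy : y = Sum.inr true) (a : V) (hx : x = Sum.inl (e, a)) :
    ∃ p : G.Walk a e.1.2, q.support = p.support.map (pairCopiesHom G e) ++ [Sum.inr true] := by
  induction q generalizing a with
  | nil => subst hy; simp at hx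
  | @cons x z y h q ih =>
    subst hx hy
    rw [SimpleGraph.Walk.cons_isPath_iff] at hq
    simp only [SimpleGraph.Walk.support_cons, List.mem_cons, not_or] at hs
    rcases z with ⟨e', b⟩ | _ | _
    · obtain ⟨rfl, hab⟩ := (pairCopies_adj_inl_inl G _ _ _ _).1 h
      obtain ⟨p, hp⟩ := ih hq.1 hs.2 rfl b rfl
      exact ⟨SimpleGraph.Walk.cons hab p, by simp [hp, pairCopiesHom_apply]⟩
    · exact absurd q.start_mem_support hs.2
    · obtain rfl := (pairCopies_adj_inl_true G _ _).1 h
      obtain rfl := (SimpleGraph.Walk.isPath_iff_nil.1 hq.1).eq_nil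
      exact ⟨SimpleGraph.Walk.nil, by simp [pairCopiesHom_apply]⟩

theorem exists_isPath_of_isPath_pairCopies
    (p' : (pairCopies G).Walk (Sum.inr false) (Sum.inr true)) (hp' : p'.IsPath) :
    ∃ (e : {q : V × V // q.1 < q.2}) (p : G.Walk e.1.1 e.1.2), p.IsPath ∧
      p'.support =
        Sum.inr false :: (p.support.map (pairCopiesHom G e) ++ [Sum.inr true]) := by
  rcases p' with _ | @⟨_, z, _, h, q⟩
  rw [SimpleGraph.Walk.cons_isPath_iff] at hp'
  rcases z with ⟨e, a⟩ | b
  · obtain rfl := (pairCopies_adj_inl_false G _ _).1 h.symm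
    obtain ⟨p, hp⟩ := exists_walk_of_isPath_inl_true G q hp'.1 hp'.2 rfl _ rfl
    refine ⟨e, p, ?_, by simp [hp]⟩
    have hnd := hp'.1.support_nodup
    rw [hp] at hnd
    exact (SimpleGraph.Walk.isPath_def p).2 (List.Nodup.of_map _ (List.Nodup.of_append_left hnd))
  · exact absurd h (not_pairCopies_adj_inr_inr G _ _)

theorem exists_isPath_pairCopies_of_isPath (e : {q : V × V // q.1 < q.2})
    (p : G.Walk e.1.1 e.1.2) (hp : p.IsPath) :
    ∃ p' : (pairCopies G).Walk (Sum.inr false) (Sum.inr true), p'.IsPath ∧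
      p'.support =
        Sum.inr false :: (p.support.map (pairCopiesHom G e) ++ [Sum.inr true]) := by
  have h₁ : (pairCopies G).Adj (Sum.inr false) (pairCopiesHom G e e.1.1) :=
    ((pairCopies_adj_inl_false G e _).2 rfl).symm
  have h₂ : (pairCopies G).Adj (pairCopiesHom G e e.1.2) (Sum.inr true) :=
    (pairCopies_adj_inl_true G e _).2 rfl
  have hsupp : (SimpleGraph.Walk.cons h₁ ((p.map (pairCopiesHom G e)).concat h₂)).support =
      Sum.inr false :: (p.support.map (pairCopiesHom G e) ++ [Sum.inr true]) := by
    simp [SimpleGraph.Walk.support_concat]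
  refine ⟨_, ?_, hsupp⟩
  rw [SimpleGraph.Walk.isPath_def, hsupp]
  have := hp.support_nodup.map (pairCopiesHom_injective G e)
  simp [List.nodup_append, this, pairCopiesHom_apply]

theorem card_pairs_lt [Fintype V] :
    Nat.card {q : V × V // q.1 < q.2} = (Fintype.card V).choose 2 := by
  rw [Nat.card_eq_fintype_card, Fintype.card_subtype, Fintype.card_product_filter_lt]

theorem ncard_openNbhd_pairCopies [Fintype V] (e : {q : V × V // q.1 < q.2}) (L : List V)
    (h₁ : e.1.1 ∈ L) (h₂ : e.1.2 ∈ L) :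
    (openNbhd (pairCopies G)
      {x | x ∈ Sum.inr false :: (L.map (pairCopiesHom G e) ++ [Sum.inr true])}).ncard =
      (openNbhd G {x | x ∈ L}).ncard + 2 * ((Fintype.card V).choose 2 - 1) := by
  let f : {q : V × V // q.1 < q.2} × Bool → ({q : V × V // q.1 < q.2} × V) ⊕ Bool :=
    fun x => Sum.inl (x.1, if x.2 then x.1.1.2 else x.1.1.1)
  have hf : Function.Injective f := by
    rintro ⟨e₁, b₁⟩ ⟨e₂, b₂⟩ h
    simp only [f, Sum.inl.injEq, Prod.mk.injEq] at h
    obtain ⟨rfl, h⟩ := h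
    have := e₁.2.ne
    have := e₁.2.ne'
    cases b₁ <;> cases b₂ <;> simp_all
  have hset : openNbhd (pairCopies G)
      {x | x ∈ Sum.inr false :: (L.map (pairCopiesHom G e) ++ [Sum.inr true])} =
      pairCopiesHom G e '' openNbhd G {x | x ∈ L} ∪ f '' ({e}ᶜ ×ˢ Set.univ) := by
    ext x
    rcases x with ⟨e', a⟩ | b
    · by_cases he : e' = e
      · subst he
        simp only [openNbhd, Set.mem_ofPred_eq, List.mem_cons, List.mem_append, List.mem_map,
          pairCopiesHom_apply, Set.mem_union, Set.mem_image, f]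
        constructor
        · rintro ⟨ha, w, hw, hadj⟩
          have ha' : a ∉ L := fun h => ha (by simp [h])
          refine Or.inl ⟨a, ⟨ha', ?_⟩, rfl⟩
          rcases hw with rfl | ⟨c, hc, rfl⟩ | rfl | h
          · rw [pairCopies_adj_inl_false] at hadj
            exact absurd (hadj ▸ h₁) ha'
          · exact ⟨c, hc, ((pairCopies_adj_inl_inl G _ _ _ _).1 hadj).2⟩
          · rw [pairCopies_adj_inl_true] at hadj
            exact absurd (hadj ▸ h₂) ha'
          · simp at h
        · rintro (⟨c, ⟨hc, w, hw, hadj⟩, h⟩ | ⟨⟨e₁, b₁⟩, h, h'⟩)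
          · obtain rfl : c = a := by simpa using h
            exact ⟨by simpa using hc, _, Or.inr (Or.inl ⟨w, hw, rfl⟩),
              (pairCopies_adj_inl_inl G _ _ _ _).2 ⟨rfl, hadj⟩⟩
          · simp at h h'
            exact absurd h'.1 h
      · simp only [openNbhd, Set.mem_ofPred_eq, List.mem_cons, List.mem_append, List.mem_map,
          pairCopiesHom_apply, Set.mem_union, Set.mem_image, f]
        constructor
        · rintro ⟨-, w, hw, hadj⟩
          right
          rcases hw with rfl | ⟨c, hc, rfl⟩ | rfl | h
          · rw [pairCopies_adj_inl_false] at hadj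
            exact ⟨(e', false), by simpa using he, by simp [hadj]⟩
          · exact absurd ((pairCopies_adj_inl_inl G _ _ _ _).1 hadj).1 he
          · rw [pairCopies_adj_inl_true] at hadj
            exact ⟨(e', true), by simpa using he, by simp [hadj]⟩
          · simp at h
        · rintro (⟨c, -, h⟩ | ⟨⟨e₁, b₁⟩, -, h⟩)
          · simp only [Sum.inl.injEq, Prod.mk.injEq] at h
            exact absurd h.1.symm he
          · simp only [Sum.inl.injEq, Prod.mk.injEq] at h
            obtain ⟨rfl, rfl⟩ := h
            refine ⟨by simp [Ne.symm he], Sum.inr b₁, by cases b₁ <;> simp, ?_⟩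
            cases b₁
            · exact (pairCopies_adj_inl_false G _ _).2 (by simp)
            · exact (pairCopies_adj_inl_true G _ _).2 (by simp)
    · cases b <;> simp [openNbhd, pairCopiesHom_apply, f]
  have hdisj : Disjoint (pairCopiesHom G e '' openNbhd G {x | x ∈ L})
      (f '' ({e}ᶜ ×ˢ Set.univ)) := by
    rw [Set.disjoint_left]
    rintro _ ⟨a, -, rfl⟩ ⟨⟨e₁, b₁⟩, h, h'⟩
    simp only [f, pairCopiesHom_apply, Sum.inl.injEq, Prod.mk.injEq] at h'
    exact h.1 h'.1
  rw [hset, Set.ncard_union_eq hdisj (Set.toFinite _) (Set.toFinite _),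
    Set.ncard_image_of_injective _ (pairCopiesHom_injective G e),
    Set.ncard_image_of_injective _ hf, Set.ncard_prod, Set.ncard_compl, Set.ncard_singleton,
    card_pairs_lt, Set.ncard_univ, Nat.card_eq_fintype_card, Fintype.card_bool, mul_comm 2]

end PairCopies

/-- Long secluded: |V(P)| ≥ k, |N| ≤ ℓ iff ... in G'. -/
theorem stmt_10 {V : Type*} [Fintype V] [LinearOrder V] (G : SimpleGraph V)
    (hn : 2 ≤ Fintype.card V) (k ℓ : ℕ) (hk : 1 ≤ k) :
    (∃ (u v : V) (p : G.Walk u v), p.IsPath ∧ 2 ≤ p.support.length ∧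
        k ≤ p.support.length ∧ (openNbhd G {x | x ∈ p.support}).ncard ≤ ℓ) ↔
      (∃ p' : (pairCopies G).Walk (Sum.inr false) (Sum.inr true), p'.IsPath ∧
        k + 2 ≤ p'.support.length ∧ (openNbhd (pairCopies G) {x | x ∈ p'.support}).ncard ≤ ℓ + 2 * ((Fintype.card V).choose 2 - 1)) := by
  constructor
  · rintro ⟨u, v, p, hp, h2, hkp, hl⟩
    have hlt : ∃ (e : {q : V × V // q.1 < q.2}) (p : G.Walk e.1.1 e.1.2), p.IsPath ∧
        k ≤ p.support.length ∧ (openNbhd G {x | x ∈ p.support}).ncard ≤ ℓ := by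
      have huv : u ≠ v := by
        rintro rfl
        obtain rfl := (SimpleGraph.Walk.isPath_iff_nil.1 hp).eq_nil
        simp at h2
      rcases lt_or_gt_of_ne huv with h | h
      · exact ⟨⟨(u, v), h⟩, p, hp, hkp, hl⟩
      · exact ⟨⟨(v, u), h⟩, p.reverse, hp.reverse, by simpa using hkp, by simpa using hl⟩
    obtain ⟨e, p, hp, hkp, hl⟩ := hlt
    obtain ⟨p', hp', hs⟩ := exists_isPath_pairCopies_of_isPath G e p hp
    refine ⟨p', hp', by rw [hs]; simpa using hkp, ?_⟩
    rw [hs, ncard_openNbhd_pairCopies G e _ p.start_mem_support p.end_mem_support]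
    lia
  · rintro ⟨p', hp', hkp, hl⟩
    obtain ⟨e, p, hp, hs⟩ := exists_isPath_of_isPath_pairCopies G p' hp'
    rw [hs, ncard_openNbhd_pairCopies G e _ p.start_mem_support p.end_mem_support] at hl
    rw [hs] at hkp
    refine ⟨_, _, p, hp, ?_, by simpa using hkp, by lia⟩
    have : p.length ≠ 0 := fun h => e.2.ne (SimpleGraph.Walk.eq_of_length_eq_zero h)
    rw [SimpleGraph.Walk.length_support]
    lia
end
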